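/- Let m, σ, ε > 0, let q < q' be real numbers, set Δ' = q' - q and q̄ = (q + q')/2, and define the privacy loss function ℓ(y) = log(f_q(y)/f_{q'}(y)). If σ²ε/Δ' > Δ'/2 + m, then the set {y ∈ ℝ : ℓ(y) ≥ ε} equals {y ∈ ℝ : y ≤ q̄ + m - εσ²/Δ'}. -/

import Mathlib

open MeasureTheory Real Filter Set

/-- The Gaussian Q-function: `Q x = (1/√(2π)) ∫_x^∞ exp (-t²/2) dt`. -/
noncomputable def gaussQ (x : ℝ) : ℝ :=
  (1 / Real.sqrt (2 * Real.pi)) * ∫ t in Set.Ioi x, Real.exp (-t ^ 2 / 2)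

/-- The standard normal CDF: `Φ x = (1/√(2π)) ∫_{-∞}^x exp (-t²/2) dt`. -/
noncomputable def stdPhi (x : ℝ) : ℝ :=
  (1 / Real.sqrt (2 * Real.pi)) * ∫ t in Set.Iic x, Real.exp (-t ^ 2 / 2)

/-- The offset-symmetric Gaussian tails (OSGT) density with parameters `m`, `σ`,
with normalization constant `S = 2√(2πσ²) Q(m/σ)`. -/
noncomputable def osgt (m σ y : ℝ) : ℝ :=
  if y ≤ 0 then
    Real.exp (-(y - m) ^ 2 / (2 * σ ^ 2)) /
      (2 * Real.sqrt (2 * Real.pi * σ ^ 2) * gaussQ (m / σ))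
  else
    Real.exp (-(y + m) ^ 2 / (2 * σ ^ 2)) /
      (2 * Real.sqrt (2 * Real.pi * σ ^ 2) * gaussQ (m / σ))

theorem gaussQ_pos (x : ℝ) : 0 < gaussQ x := by
  have hint : Integrable (fun t : ℝ => Real.exp (-t ^ 2 / 2)) := by
    refine (integrable_exp_neg_mul_sq (b := 1 / 2) (by norm_num)).congr (.of_forall fun t => ?_)
    ring_nf
  have : NeZero (volume.restrict (Set.Ioi x)) :=
    ⟨by simp [Measure.restrict_eq_zero]⟩
  exact mul_pos (by positivity) (integral_exp_pos hint.integrableOn)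

theorem osgt_eq_exp_abs {m σ : ℝ} (y : ℝ) :
    osgt m σ y = Real.exp (-(|y| + m) ^ 2 / (2 * σ ^ 2)) /
      (2 * Real.sqrt (2 * Real.pi * σ ^ 2) * gaussQ (m / σ)) := by
  unfold osgt
  split_ifs with h
  · rw [abs_of_nonpos h]
    ring_nf
  · rw [abs_of_pos (not_le.mp h)]

theorem log_osgt_div_osgt {m σ : ℝ} (hσ : 0 < σ) (x y : ℝ) :
    Real.log (osgt m σ x / osgt m σ y) = ((|y| + m) ^ 2 - (|x| + m) ^ 2) / (2 * σ ^ 2) := by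
  have hS : 2 * Real.sqrt (2 * Real.pi * σ ^ 2) * gaussQ (m / σ) ≠ 0 :=
    (mul_pos (by positivity) (gaussQ_pos _)).ne'
  rw [osgt_eq_exp_abs, osgt_eq_exp_abs, div_div_div_cancel_right₀ hS, ← Real.exp_sub, Real.log_exp]
  ring

/-- the privacy-loss level set for the large-`ε` regime. -/
theorem osgt_loss_set_large_eps (m σ ε : ℝ) (hm : 0 < m) (hσ : 0 < σ) (hε : 0 < ε)
    (q q' : ℝ) (hqq : q < q')
    (Δ' qbar : ℝ) (hΔ' : Δ' = q' - q) (hqbar : qbar = (q + q') / 2)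
    (hcase : σ ^ 2 * ε / Δ' > Δ' / 2 + m) :
    {y : ℝ | Real.log (osgt m σ (y - q) / osgt m σ (y - q')) ≥ ε} =
      {y : ℝ | y ≤ qbar + m - ε * σ ^ 2 / Δ'} := by
  have hΔ : 0 < Δ' := by linarith
  ext y
  have hthreshold : qbar + m - ε * σ ^ 2 / Δ' < q := by
    rw [mul_comm ε]
    linarith
  have hlarge : (Δ' / 2 + m) * Δ' < σ ^ 2 * ε := (lt_div_iff₀ hΔ).mp hcase
  rw [mem_ofPred_eq, mem_ofPred_eq, log_osgt_div_osgt hσ, ge_iff_le, le_div_iff₀ (by positivity)]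
  rcases le_or_gt y q with hy | hy
  · rw [abs_of_nonpos (by linarith : y - q ≤ 0), abs_of_nonpos (by linarith : y - q' ≤ 0),
      le_sub_comm (a := y), div_le_iff₀ hΔ]
    subst hΔ' hqbar
    constructor <;> intro h <;> linarith
  · refine iff_of_false (not_le.mpr ?_) (by linarith)
    rw [abs_of_pos (by linarith : 0 < y - q)]
    subst hΔ'
    rcases le_or_gt y q' with hy' | hy'
    · rw [abs_of_nonpos (by linarith : y - q' ≤ 0)]
      nlinarith [mul_pos (sub_pos.mpr hy) (add_pos hΔ (mul_pos two_pos hm))]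
    · rw [abs_of_pos (by linarith : 0 < y - q')]
      nlinarith [mul_pos hΔ (sub_pos.mpr hy), mul_pos hΔ (sub_pos.mpr hy'), mul_pos hΔ hm]
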